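/- arXiv:2501.18381 — 2 statements merged into one kernel-verified Lean document; each statement's English description precedes it below -/
import Mathlib

section
/- Let E be a finite-dimensional real inner product space, X ⊆ E a compact convex set of diameter at most D with D > 0, and fix η > 0, L ≥ 0, μ ≥ 0, M ≥ 0 and a positive integer T. For t = 1,…,T let ℓ_t, ℓ̃_t : E → ℝ be differentiable functions that are μ-strongly convex on X, L-smooth on X, and satisfy ‖∇ℓ_t(x)‖ ≤ M and ‖∇ℓ̃_t(x)‖ ≤ M for all x ∈ X. Let ε_t > 0 satisfy ε_t ≤ (1/(8η))·((t+1)²·(15 + 8η²L² + 2η²M²/D²))⁻¹ for each t. Let x_1 ∈ X and let (x_t)_{t=1}^{T+1}, (x̃_t)_{t=1}^{T} be RIOD inexact iterates for the losses ℓ_t, hints ℓ̃_t, step η and tolerances ε_t. Then for every choice of comparators u_1,…,u_{T+1} ∈ X, writing P_T := ∑_{t=1}^{T} ‖u_t − u_{t+1}‖: ∑_{t=1}^{T} (ℓ_t(x̃_t) − ℓ_t(u_t)) ≤ (2·P_T·D + 3D²)/(2η) + ∑_{t=1}^{T} (η‖∇ℓ_t(x̃_t) − ∇ℓ̃_t(x̃_t)‖²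 − (μ/4)‖x_{t+1} − u_t‖²). -/
section HilbertSpace

variable {E : Type*} [NormedAddCommGroup E] [InnerProductSpace ℝ E]

/-- Polarization of the squared distance to `x` around the point `y`. -/
theorem norm_sub_sq_expand (x y z : E) :
    ‖z - x‖ ^ 2 = ‖y - x‖ ^ 2 + 2 * inner ℝ (y - x) (z - y) + ‖z - y‖ ^ 2 := by
  rw [← norm_add_sq_real]
  congr 2
  abel

variable [CompleteSpace E]

/-- First-order lower bound for a differentiable convex function. -/
theorem ConvexOn.add_inner_gradient_le {X : Set E} {f : E → ℝ} (hf : ConvexOn ℝ X f) {y z : E}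
    (hy : y ∈ X) (hz : z ∈ X) (hd : DifferentiableAt ℝ f y) :
    f y + inner ℝ (gradient f y) (z - y) ≤ f z := by
  let g : ℝ →ᵃ[ℝ] E := AffineMap.lineMap y z
  have hconv : ConvexOn ℝ (g ⁻¹' X) (f ∘ g) := hf.comp_affineMap g
  have hderiv : HasDerivAt (f ∘ g) (fderiv ℝ f y (z - y)) 0 := by
    have h1 : HasDerivAt g (z - y) (0 : ℝ) := AffineMap.hasDerivAt_lineMap
    have h2 : HasFDerivAt f (fderiv ℝ f y) (g 0) := by
      simpa [g] using hd.hasFDerivAt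
    exact h2.comp_hasDerivAt 0 h1
  have h := hconv.le_slope_of_hasDerivAt (x := 0) (y := 1) (by simpa [g] using hy)
    (by simpa [g] using hz) one_pos hderiv
  rw [slope_def_field] at h
  simp only [Function.comp_apply, g, AffineMap.lineMap_apply_zero, AffineMap.lineMap_apply_one,
    sub_zero, div_one] at h
  rw [inner_gradient_left]
  linarith

/-- First-order lower bound for a differentiable strongly convex function. -/
theorem add_inner_gradient_add_sq_le_of_convexOn_sub_sq {X : Set E} {f : E → ℝ} {μ : ℝ}
    (hf : ConvexOn ℝ X (fun z => f z - μ / 2 * ‖z‖ ^ 2)) {y z : E}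
    (hy : y ∈ X) (hz : z ∈ X) (hd : DifferentiableAt ℝ f y) :
    f y + inner ℝ (gradient f y) (z - y) + μ / 2 * ‖z - y‖ ^ 2 ≤ f z := by
  have hq : HasFDerivAt (fun z : E => μ / 2 * ‖z‖ ^ 2) ((μ / 2) • (2 • innerSL ℝ y)) y :=
    (hasStrictFDerivAt_norm_sq y).hasFDerivAt.const_mul _
  have hg : HasFDerivAt (fun z => f z - μ / 2 * ‖z‖ ^ 2)
      (fderiv ℝ f y - (μ / 2) • (2 • innerSL ℝ y)) y := hd.hasFDerivAt.sub hq
  have h := hf.add_inner_gradient_le hy hz hg.differentiableAt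
  rw [inner_gradient_left, hg.fderiv] at h
  have e := norm_sub_sq_expand 0 y z
  simp only [sub_zero] at e
  rw [inner_gradient_left]
  simp only [sub_apply, smul_apply, innerSL_apply_apply,
    smul_eq_mul, nsmul_eq_mul, Nat.cast_ofNat] at h
  rw [e] at h
  linarith

/-- First-order optimality condition for a proximal step over a convex set. -/
theorem IsMinOn.inner_gradient_add_prox_nonneg {X : Set E} (hX : Convex ℝ X) {f : E → ℝ}
    {c : ℝ} {x y z : E} (hmin : IsMinOn (fun z => f z + c * ‖z - x‖ ^ 2) X y)
    (hy : y ∈ X) (hz : z ∈ X) (hd : DifferentiableAt ℝ f y) :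
    0 ≤ inner ℝ (gradient f y) (z - y) + 2 * c * inner ℝ (y - x) (z - y) := by
  have hq : HasFDerivAt (fun z : E => c * ‖z - x‖ ^ 2) (c • (2 • innerSL ℝ (y - x))) y := by
    have h := ((hasStrictFDerivAt_norm_sq (y - x)).hasFDerivAt.comp y
      ((hasFDerivAt_id y).sub_const x)).const_mul c
    simpa using h
  have h := hmin.localize.hasFDerivWithinAt_nonneg
    (hd.hasFDerivAt.add hq).hasFDerivWithinAt
    (sub_mem_posTangentConeAt_of_segment_subset (hX.segment_subset hy hz))
  rw [inner_gradient_left]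
  simp only [add_apply, smul_apply, innerSL_apply_apply,
    smul_eq_mul, nsmul_eq_mul, Nat.cast_ofNat] at h
  linarith

/-- Quadratic growth of a strongly convex proximal objective around its minimizer. -/
theorem IsMinOn.prox_quadratic_growth {X : Set E} (hX : Convex ℝ X) {f : E → ℝ}
    {c μ : ℝ} {x y z : E} (hf : ConvexOn ℝ X (fun z => f z - μ / 2 * ‖z‖ ^ 2))
    (hmin : IsMinOn (fun z => f z + c * ‖z - x‖ ^ 2) X y)
    (hy : y ∈ X) (hz : z ∈ X) (hd : DifferentiableAt ℝ f y) :
    f y + c * ‖y - x‖ ^ 2 + (c + μ / 2) * ‖z - y‖ ^ 2 ≤ f z + c * ‖z - x‖ ^ 2 := by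
  have h1 := add_inner_gradient_add_sq_le_of_convexOn_sub_sq hf hy hz hd
  have h2 := hmin.inner_gradient_add_prox_nonneg hX hy hz hd
  rw [norm_sub_sq_expand x y z]
  linarith

/-- Variational inequality, up to an explicit error, at an approximate proximal minimizer `a`
of a convex function whose gradient is Lipschitz along the segment to the minimizer `y`. -/
theorem IsMinOn.inner_gradient_le_of_approx_prox {X : Set E} (hX : Convex ℝ X) {f : E → ℝ}
    {η L μ δ : ℝ} (hη : 0 < η) {x y a b : E}
    (hmin : IsMinOn (fun z => f z + 1 / (2 * η) * ‖z - x‖ ^ 2) X y)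
    (hf : ConvexOn ℝ X (fun z => f z - μ / 2 * ‖z‖ ^ 2)) (hμ : 0 ≤ μ)
    (hy : y ∈ X) (ha : a ∈ X) (hb : b ∈ X) (hd : DifferentiableAt ℝ f y)
    (hL : ‖gradient f a - gradient f y‖ ≤ L * ‖a - y‖)
    (hδ : (f a + 1 / (2 * η) * ‖a - x‖ ^ 2) - (f y + 1 / (2 * η) * ‖y - x‖ ^ 2) ≤ δ) :
    inner ℝ (gradient f a) (a - b) ≤
      1 / (2 * η) * (‖b - x‖ ^ 2 - ‖a - x‖ ^ 2 - ‖a - b‖ ^ 2) + δ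
        + (L + 1 / η) * ‖a - y‖ * ‖a - b‖ := by
  have h1 := hmin.inner_gradient_add_prox_nonneg hX hy hb hd
  have h2 := add_inner_gradient_add_sq_le_of_convexOn_sub_sq hf hy ha hd
  have h3 : 0 ≤ μ / 2 * ‖a - y‖ ^ 2 := by positivity
  have h4 : inner ℝ (gradient f a - gradient f y) (a - b) ≤ L * ‖a - y‖ * ‖a - b‖ :=
    (real_inner_le_norm _ _).trans (by gcongr)
  have h5 : inner ℝ (a - y) (a - b) ≤ ‖a - y‖ * ‖a - b‖ := real_inner_le_norm _ _
  have e1 := norm_sub_sq_expand x y a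
  have e2 := norm_sub_sq_expand x a b
  have k : 1 / η = 2 * (1 / (2 * η)) := by field_simp
  have hc : 0 < 1 / (2 * η) := by positivity
  rw [k]
  set c := 1 / (2 * η)
  rw [norm_sub_rev b a] at e2
  have h5' := mul_le_mul_of_nonneg_left h5 (by positivity : 0 ≤ 2 * c)
  have e3 : inner ℝ (gradient f y) (b - y) =
      inner ℝ (gradient f y) (a - y) - inner ℝ (gradient f y) (a - b) := by
    rw [← inner_sub_right]; congr 1; abel
  have e4 : inner ℝ (y - x) (b - y) =
      inner ℝ (y - x) (a - y) - inner ℝ (y - x) (a - b) := by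
    rw [← inner_sub_right]; congr 1; abel
  have e5 : inner ℝ (a - x) (b - a) = - inner ℝ (y - x) (a - b) - inner ℝ (a - y) (a - b) := by
    rw [← neg_sub a b, inner_neg_right, ← sub_add_sub_cancel a y x, inner_add_left]; ring
  rw [inner_sub_left] at h4
  rw [e3, e4] at h1
  rw [e5] at e2
  have h6 : 0 ≤ c * ‖a - y‖ ^ 2 := by positivity
  rw [e2]
  rw [e1] at hδ ⊢
  linarith

end HilbertSpace

/-- Scalar bookkeeping for one inexact optimistic step: the tolerance `ε` and the first-order
terms in the inexactness are absorbed by the negative quadratic terms, up to `D² / (η n²)`. -/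
theorem riod_scalar_error {η L D ε n p q q' r s v : ℝ} (hη : 0 < η)
    (hn : 1 ≤ n) (hε : 0 < ε)
    (hεn : 8 * η * ε * n ^ 2 * (15 + 8 * η ^ 2 * L ^ 2) ≤ 1)
    (hq : 0 ≤ q) (hqD : q ≤ D) (hq' : 0 ≤ q') (hqD' : q' ≤ D)
    (hp : 1 / (2 * η) * p ^ 2 ≤ ε * q ^ 2) (hr : 1 / (2 * η) * r ^ 2 ≤ ε * q' ^ 2)
    (hqv : q ≤ v + s + p) :
    2 * (ε * q ^ 2) + ε * q' ^ 2 + (L + 1 / η) * r * s + 1 / (2 * η) * (2 * D * p)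
        - 1 / (2 * η) * v ^ 2 - 1 / (4 * η) * s ^ 2
      ≤ D ^ 2 / η * (1 / n ^ 2) := by
  have hn0 : 0 < n := by linarith
  have hw : 0 < 1 / n ^ 2 := by positivity
  have hw1 : 1 / n ^ 2 ≤ 1 := by
    rw [div_le_one (by positivity)]
    exact one_le_pow₀ hn
  have hεw : 8 * η * ε * (15 + 8 * η ^ 2 * L ^ 2) ≤ 1 / n ^ 2 := by
    rw [le_div_iff₀ (by positivity)]; linarith
  have hp' : p ^ 2 ≤ 2 * η * ε * q ^ 2 := by
    rw [one_div_mul_eq_div, div_le_iff₀ (by positivity)] at hp; linarith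
  have hr' : r ^ 2 ≤ 2 * η * ε * q' ^ 2 := by
    rw [one_div_mul_eq_div, div_le_iff₀ (by positivity)] at hr; linarith
  have hq2 : q ^ 2 ≤ D ^ 2 := by gcongr
  have hq2' : q' ^ 2 ≤ D ^ 2 := by gcongr
  have hηε : 0 < η * ε := by positivity
  have hεn' : 120 * (η * ε * n ^ 2) ≤ 1 := by
    have : 0 ≤ 8 * η * ε * n ^ 2 * (8 * η ^ 2 * L ^ 2) := by positivity
    linarith
  have hεw' : 120 * (η * ε) ≤ 1 / n ^ 2 := by
    have : 0 ≤ 8 * η * ε * (8 * η ^ 2 * L ^ 2) := by positivity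
    linarith
  -- cross term between the two inexactness radii
  have b1 : (η * L + 1) * r * s ≤ s ^ 2 / 8 + 8 * (η * ε) * (1 + η ^ 2 * L ^ 2) * D ^ 2 := by
    have t1 : (η * L + 1) * r * s ≤ s ^ 2 / 8 + 2 * ((η * L + 1) ^ 2 * r ^ 2) := by
      linarith [sq_nonneg (s - 4 * ((η * L + 1) * r))]
    have t2 : (η * L + 1) ^ 2 ≤ 2 * (1 + η ^ 2 * L ^ 2) := by linarith [sq_nonneg (η * L - 1)]
    have t3 : r ^ 2 ≤ 2 * η * ε * D ^ 2 := hr'.trans (by gcongr)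
    have t4 : (η * L + 1) ^ 2 * r ^ 2 ≤ 2 * (1 + η ^ 2 * L ^ 2) * (2 * η * ε * D ^ 2) := by
      gcongr
    linarith
  -- first-order term in the distance between exact and inexact iterates
  have b2 : D * p ≤ D ^ 2 * (1 / n ^ 2) / 2 + q ^ 2 / 120 := by
    have t1 : D * p ≤ D ^ 2 * (1 / n ^ 2) / 2 + n ^ 2 * p ^ 2 / 2 := by
      have e : D * p = (D * (1 / n)) * (n * p) := by field_simp
      have e' : D ^ 2 * (1 / n ^ 2) = (D * (1 / n)) ^ 2 := by field_simp
      rw [e, e']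
      linarith [sq_nonneg (D * (1 / n) - n * p)]
    have t2 : n ^ 2 * p ^ 2 ≤ n ^ 2 * (2 * η * ε * q ^ 2) := by gcongr
    have t3 : 120 * (η * ε * n ^ 2) * q ^ 2 ≤ 1 * q ^ 2 := by gcongr
    linarith
  have b3 : q ^ 2 ≤ 3 * (v ^ 2 + s ^ 2 + p ^ 2) := by
    have : q ^ 2 ≤ (v + s + p) ^ 2 := by gcongr
    linarith [sq_nonneg (v - s), sq_nonneg (v - p), sq_nonneg (s - p)]
  have b4 : p ^ 2 ≤ D ^ 2 * (1 / n ^ 2) / 60 := by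
    have t1 : 2 * η * ε * q ^ 2 ≤ 2 * η * ε * D ^ 2 := by gcongr
    have t2 : 120 * (η * ε) * D ^ 2 ≤ 1 / n ^ 2 * D ^ 2 := by gcongr
    linarith
  have b5 : η * ε * q ^ 2 ≤ η * ε * D ^ 2 := by gcongr
  have b6 : η * ε * q' ^ 2 ≤ η * ε * D ^ 2 := by gcongr
  have b7 : 8 * η * ε * (15 + 8 * η ^ 2 * L ^ 2) * D ^ 2 ≤ 1 / n ^ 2 * D ^ 2 := by gcongr
  have b8 : 0 ≤ η * ε * D ^ 2 := by positivity
  have b9 : 0 ≤ η * ε * (η ^ 2 * L ^ 2) * D ^ 2 := by positivity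
  have b10 : 0 ≤ D ^ 2 * (1 / n ^ 2) := by positivity
  have key : 2 * (η * ε * q ^ 2) + η * ε * q' ^ 2 + (η * L + 1) * r * s + D * p
      - v ^ 2 / 2 - s ^ 2 / 4 ≤ D ^ 2 * (1 / n ^ 2) := by
    have t1 : 3 * (η * ε * D ^ 2) + 8 * (η * ε) * (1 + η ^ 2 * L ^ 2) * D ^ 2
        ≤ D ^ 2 * (1 / n ^ 2) / 8 := by linarith only [b7, b8, b9]
    have t2 := sq_nonneg v
    have t3 := sq_nonneg s
    generalize 8 * (η * ε) * (1 + η ^ 2 * L ^ 2) * D ^ 2 = A at t1 b1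
    generalize D ^ 2 * (1 / n ^ 2) = B at t1 b2 b4 b10 ⊢
    linarith only [t1, t2, t3, b1, b2, b3, b4, b5, b6, b10]
  have e : 2 * (ε * q ^ 2) + ε * q' ^ 2 + (L + 1 / η) * r * s + 1 / (2 * η) * (2 * D * p)
        - 1 / (2 * η) * v ^ 2 - 1 / (4 * η) * s ^ 2
      = (2 * (η * ε * q ^ 2) + η * ε * q' ^ 2 + (η * L + 1) * r * s + D * p
      - v ^ 2 / 2 - s ^ 2 / 4) / η := by
    field_simp
  rw [e, div_mul_eq_mul_div]
  gcongr

/-- Regret of a single inexact optimistic proximal step against an arbitrary comparator. -/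
theorem riod_one_step {E : Type*} [NormedAddCommGroup E] [InnerProductSpace ℝ E] [CompleteSpace E]
    {X : Set E} (hX : Convex ℝ X) {D : ℝ} (hXD : ∀ y ∈ X, ∀ z ∈ X, ‖y - z‖ ≤ D)
    {η L μ ε n : ℝ} (hη : 0 < η) (hμ : 0 ≤ μ) (hn : 1 ≤ n) (hε : 0 < ε)
    (hεn : 8 * η * ε * n ^ 2 * (15 + 8 * η ^ 2 * L ^ 2) ≤ 1)
    {f fh : E → ℝ} (hf : Differentiable ℝ f) (hfh : Differentiable ℝ fh)
    (hfc : ConvexOn ℝ X (fun z => f z - μ / 2 * ‖z‖ ^ 2))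
    (hfhc : ConvexOn ℝ X (fun z => fh z - μ / 2 * ‖z‖ ^ 2))
    (hfhL : ∀ y ∈ X, ∀ z ∈ X, ‖gradient fh y - gradient fh z‖ ≤ L * ‖y - z‖)
    {x a as b bs u : E} (hx : x ∈ X) (ha : a ∈ X) (has : as ∈ X) (hb : b ∈ X) (hbs : bs ∈ X)
    (hu : u ∈ X)
    (hasmin : IsMinOn (fun z => fh z + 1 / (2 * η) * ‖z - x‖ ^ 2) X as)
    (hbsmin : IsMinOn (fun z => f z + 1 / (2 * η) * ‖z - x‖ ^ 2) X bs)
    (hae : (fh a + 1 / (2 * η) * ‖a - x‖ ^ 2) - (fh as + 1 / (2 * η) * ‖as - x‖ ^ 2)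
      ≤ ε * ‖x - as‖ ^ 2)
    (hbe : (f b + 1 / (2 * η) * ‖b - x‖ ^ 2) - (f bs + 1 / (2 * η) * ‖bs - x‖ ^ 2)
      ≤ ε * ‖x - bs‖ ^ 2) :
    f a - f u ≤ η * ‖gradient f a - gradient fh a‖ ^ 2 - μ / 4 * ‖b - u‖ ^ 2
      + 1 / (2 * η) * (‖u - x‖ ^ 2 - ‖u - b‖ ^ 2) + D ^ 2 / η * (1 / n ^ 2) := by
  have ga := hasmin.prox_quadratic_growth hX hfhc has ha (hfh as)
  have gb := hbsmin.prox_quadratic_growth hX hfc hbs hb (hf bs)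
  have gu := hbsmin.prox_quadratic_growth hX hfc hbs hu (hf bs)
  have hc : 0 < 1 / (2 * η) := by positivity
  have m1 : 0 ≤ μ / 2 * ‖a - as‖ ^ 2 := by positivity
  have m2 : 0 ≤ μ / 2 * ‖b - bs‖ ^ 2 := by positivity
  have m3 : 0 ≤ 1 / (2 * η) * ‖b - bs‖ ^ 2 := by positivity
  have tri : ‖x - bs‖ ≤ ‖a - x‖ + ‖a - b‖ + ‖b - bs‖ := by
    rw [norm_sub_rev a x]
    calc ‖x - bs‖ = ‖(x - a) + (a - b) + (b - bs)‖ := by congr 1; abel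
      _ ≤ _ := norm_add₃_le
  have err := riod_scalar_error (p := ‖b - bs‖) (q := ‖x - bs‖) (q' := ‖x - as‖)
    (r := ‖a - as‖) (s := ‖a - b‖) (v := ‖a - x‖) hη hn hε hεn
    (norm_nonneg _) (hXD _ hx _ hbs) (norm_nonneg _) (hXD _ hx _ has)
    (by linarith) (by linarith) tri
  have tri2 : ‖u - b‖ ≤ ‖u - bs‖ + ‖b - bs‖ := by
    rw [norm_sub_rev b bs]
    exact norm_sub_le_norm_sub_add_norm_sub _ _ _
  have i2 : ‖u - b‖ ^ 2 - ‖u - bs‖ ^ 2 ≤ 2 * D * ‖b - bs‖ := by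
    nlinarith [hXD _ hu _ hb, hXD _ hu _ hbs, norm_nonneg (b - bs), norm_nonneg (u - b),
      norm_nonneg (u - bs)]
  have i2' := mul_le_mul_of_nonneg_left i2 hc.le
  have i3 : ‖u - b‖ ^ 2 ≤ 2 * ‖u - bs‖ ^ 2 + 2 * ‖b - bs‖ ^ 2 := by
    nlinarith [sq_nonneg (‖u - bs‖ - ‖b - bs‖), norm_nonneg (u - b)]
  have i3' := mul_le_mul_of_nonneg_left i3 (by positivity : 0 ≤ μ / 4)
  have i4 := add_inner_gradient_add_sq_le_of_convexOn_sub_sq hfc ha hb (hf a)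
  have m4 : 0 ≤ μ / 2 * ‖b - a‖ ^ 2 := by positivity
  have i5 : inner ℝ (gradient f a - gradient fh a) (a - b) ≤
      η * ‖gradient f a - gradient fh a‖ ^ 2 + 1 / (4 * η) * ‖a - b‖ ^ 2 := by
    refine (real_inner_le_norm _ _).trans ?_
    have e : η * ‖gradient f a - gradient fh a‖ ^ 2 + 1 / (4 * η) * ‖a - b‖ ^ 2
        - ‖gradient f a - gradient fh a‖ * ‖a - b‖
        = η * (‖gradient f a - gradient fh a‖ - ‖a - b‖ / (2 * η)) ^ 2 := by
      field_simp
      ring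
    have : 0 ≤ η * (‖gradient f a - gradient fh a‖ - ‖a - b‖ / (2 * η)) ^ 2 := by positivity
    linarith
  have i6 := hasmin.inner_gradient_le_of_approx_prox hX hη hfhc hμ has ha hb (hfh as)
    (hfhL _ ha _ has) hae
  rw [inner_sub_left] at i5
  have e4 : inner ℝ (gradient f a) (b - a) = - inner ℝ (gradient f a) (a - b) := by
    rw [← inner_neg_right, neg_sub]
  rw [e4] at i4
  have e5 : 1 / (4 * η) * ‖a - b‖ ^ 2 = 1 / (2 * η) * ‖a - b‖ ^ 2 / 2 := by
    field_simp
    norm_num [mul_comm]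
  rw [norm_sub_rev b u]
  rw [e5] at i5 err
  linarith

/-- The inverse squares `1 / (t + 1)²`, `1 ≤ t ≤ T`, sum to at most one. -/
theorem sum_Icc_one_div_add_one_sq_le_one (T : ℕ) :
    ∑ t ∈ Finset.Icc 1 T, 1 / ((t : ℝ) + 1) ^ 2 ≤ 1 := by
  have h : ∑ t ∈ Finset.Icc 1 T, 1 / ((t : ℝ) + 1) ^ 2 ≤ 1 - 1 / ((T : ℝ) + 1) := by
    induction T with
    | zero => simp
    | succ k ih =>
      rw [Finset.sum_Icc_succ_top (by omega)]
      have : 1 / (((k + 1 : ℕ) : ℝ) + 1) ^ 2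
          ≤ 1 / ((k : ℝ) + 1) - 1 / (((k + 1 : ℕ) : ℝ) + 1) := by
        push_cast
        rw [div_sub_div _ _ (by positivity) (by positivity),
          div_le_div_iff₀ (by positivity) (by positivity)]
        nlinarith [(Nat.cast_nonneg k : (0 : ℝ) ≤ k)]
      linarith
  have : 0 ≤ 1 / ((T : ℝ) + 1) := by positivity
  linarith

/-- Telescoping of squared distances to a moving comparator in a set of diameter at most `D`. -/
theorem sum_Icc_sq_norm_sub_telescope_le {E : Type*} [SeminormedAddCommGroup E] {X : Set E}
    {D : ℝ} (hXD : ∀ y ∈ X, ∀ z ∈ X, ‖y - z‖ ≤ D) {u x : ℕ → E} (T : ℕ)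
    (hu : ∀ t ∈ Finset.Icc 1 (T + 1), u t ∈ X) (hx : ∀ t ∈ Finset.Icc 1 (T + 1), x t ∈ X) :
    ∑ t ∈ Finset.Icc 1 T, (‖u t - x t‖ ^ 2 - ‖u t - x (t + 1)‖ ^ 2)
      ≤ 2 * (∑ t ∈ Finset.Icc 1 T, ‖u t - u (t + 1)‖) * D + D ^ 2 := by
  have h1 : (1 : ℕ) ∈ Finset.Icc 1 (T + 1) := by simp
  have hstep : ∀ t ∈ Finset.Icc 1 T, ‖u t - x t‖ ^ 2 - ‖u t - x (t + 1)‖ ^ 2 ≤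
      2 * D * ‖u t - u (t + 1)‖
        - (‖u (t + 1) - x (t + 1)‖ ^ 2 - ‖u t - x t‖ ^ 2) := by
    intro t ht
    rw [Finset.mem_Icc] at ht
    have m0 : t ∈ Finset.Icc 1 (T + 1) := by rw [Finset.mem_Icc]; omega
    have m1 : t + 1 ∈ Finset.Icc 1 (T + 1) := by rw [Finset.mem_Icc]; omega
    have tri : ‖u (t + 1) - x (t + 1)‖ ≤ ‖u t - u (t + 1)‖ + ‖u t - x (t + 1)‖ := by
      rw [norm_sub_rev (u t) (u (t + 1))]
      exact norm_sub_le_norm_sub_add_norm_sub _ _ _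
    nlinarith [hXD _ (hu _ m1) _ (hx _ m1), hXD _ (hu _ m0) _ (hx _ m1),
      norm_nonneg (u t - u (t + 1)), norm_nonneg (u t - x (t + 1)),
      norm_nonneg (u (t + 1) - x (t + 1))]
  have hsum := Finset.sum_le_sum hstep
  have htel : ∑ t ∈ Finset.Icc 1 T, (‖u (t + 1) - x (t + 1)‖ ^ 2 - ‖u t - x t‖ ^ 2)
      = ‖u (T + 1) - x (T + 1)‖ ^ 2 - ‖u 1 - x 1‖ ^ 2 := by
    rw [← Finset.Ico_add_one_right_eq_Icc]
    exact Finset.sum_Ico_sub (fun t => ‖u t - x t‖ ^ 2) (by omega)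
  rw [Finset.sum_sub_distrib (fun t => 2 * D * ‖u t - u (t + 1)‖), htel, ← Finset.mul_sum] at hsum
  have hD : ‖u 1 - x 1‖ ^ 2 ≤ D ^ 2 := by
    have := hXD _ (hu _ h1) _ (hx _ h1)
    gcongr
  nlinarith [sq_nonneg ‖u (T + 1) - x (T + 1)‖]

/-- **RIOD (dynamic regret), Euclidean case.** Theorem A.1 of
"Implicit Riemannian Optimism with Applications to Min-Max Problems". -/
theorem riod_dynamic_regret
    {E : Type*} [NormedAddCommGroup E] [InnerProductSpace ℝ E] [FiniteDimensional ℝ E]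
    (X : Set E) (hXcomp : IsCompact X) (hXconv : Convex ℝ X)
    (D : ℝ) (hD : 0 < D) (hXdiam : Metric.diam X ≤ D)
    (η : ℝ) (hη : 0 < η) (L : ℝ) (hL : 0 ≤ L) (μ : ℝ) (hμ : 0 ≤ μ) (M : ℝ) (hM : 0 ≤ M)
    (T : ℕ) (hT : 0 < T)
    (ℓ ℓh : ℕ → E → ℝ)
    (hdiff : ∀ t ∈ Finset.Icc 1 T, Differentiable ℝ (ℓ t) ∧ Differentiable ℝ (ℓh t))
    (hsc : ∀ t ∈ Finset.Icc 1 T,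
      ConvexOn ℝ X (fun z => ℓ t z - μ / 2 * ‖z‖ ^ 2) ∧
      ConvexOn ℝ X (fun z => ℓh t z - μ / 2 * ‖z‖ ^ 2))
    (hsmooth : ∀ t ∈ Finset.Icc 1 T, ∀ x ∈ X, ∀ y ∈ X,
      ‖gradient (ℓ t) x - gradient (ℓ t) y‖ ≤ L * ‖x - y‖ ∧
      ‖gradient (ℓh t) x - gradient (ℓh t) y‖ ≤ L * ‖x - y‖)
    (hgradbdd : ∀ t ∈ Finset.Icc 1 T, ∀ x ∈ X,
      ‖gradient (ℓ t) x‖ ≤ M ∧ ‖gradient (ℓh t) x‖ ≤ M)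
    (ε : ℕ → ℝ)
    (hε : ∀ t ∈ Finset.Icc 1 T, 0 < ε t ∧
      ε t ≤ 1 / (8 * η) *
        (((t : ℝ) + 1) ^ 2 * (15 + 8 * η ^ 2 * L ^ 2 + 2 * η ^ 2 * M ^ 2 / D ^ 2))⁻¹)
    (x xh xs xhs : ℕ → E)
    (hx1 : x 1 ∈ X)
    (hmem : ∀ t ∈ Finset.Icc 1 T, xh t ∈ X ∧ x (t + 1) ∈ X)
    (hxhs : ∀ t ∈ Finset.Icc 1 T, xhs t ∈ X ∧
      IsMinOn (fun z => ℓh t z + 1 / (2 * η) * ‖z - x t‖ ^ 2) X (xhs t))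
    (hxs : ∀ t ∈ Finset.Icc 1 T, xs (t + 1) ∈ X ∧
      IsMinOn (fun z => ℓ t z + 1 / (2 * η) * ‖z - x t‖ ^ 2) X (xs (t + 1)))
    (hinexact1 : ∀ t ∈ Finset.Icc 1 T,
      (ℓh t (xh t) + 1 / (2 * η) * ‖xh t - x t‖ ^ 2)
        - (ℓh t (xhs t) + 1 / (2 * η) * ‖xhs t - x t‖ ^ 2)
        ≤ ε t * ‖x t - xhs t‖ ^ 2)
    (hinexact2 : ∀ t ∈ Finset.Icc 1 T,
      (ℓ t (x (t + 1)) + 1 / (2 * η) * ‖x (t + 1) - x t‖ ^ 2)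
        - (ℓ t (xs (t + 1)) + 1 / (2 * η) * ‖xs (t + 1) - x t‖ ^ 2)
        ≤ ε t * ‖x t - xs (t + 1)‖ ^ 2)
    (u : ℕ → E) (hu : ∀ t ∈ Finset.Icc 1 (T + 1), u t ∈ X) :
    ∑ t ∈ Finset.Icc 1 T, (ℓ t (xh t) - ℓ t (u t))
      ≤ (2 * (∑ t ∈ Finset.Icc 1 T, ‖u t - u (t + 1)‖) * D + 3 * D ^ 2) / (2 * η)
        + ∑ t ∈ Finset.Icc 1 T,
            (η * ‖gradient (ℓ t) (xh t) - gradient (ℓh t) (xh t)‖ ^ 2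
              - μ / 4 * ‖x (t + 1) - u t‖ ^ 2) := by
  have hXD : ∀ y ∈ X, ∀ z ∈ X, ‖y - z‖ ≤ D := fun y hy z hz => by
    rw [← dist_eq_norm]
    exact (Metric.dist_le_diam_of_mem hXcomp.isBounded hy hz).trans hXdiam
  have hxX : ∀ t ∈ Finset.Icc 1 (T + 1), x t ∈ X := by
    intro t ht
    rw [Finset.mem_Icc] at ht
    rcases ht.1.eq_or_lt with h | h
    · exact h ▸ hx1
    · obtain ⟨k, rfl⟩ : ∃ k, t = k + 1 := ⟨t - 1, by omega⟩
      exact (hmem k (by rw [Finset.mem_Icc]; omega)).2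
  have hstep : ∀ t ∈ Finset.Icc 1 T, ℓ t (xh t) - ℓ t (u t) ≤
      (η * ‖gradient (ℓ t) (xh t) - gradient (ℓh t) (xh t)‖ ^ 2
        - μ / 4 * ‖x (t + 1) - u t‖ ^ 2)
      + 1 / (2 * η) * (‖u t - x t‖ ^ 2 - ‖u t - x (t + 1)‖ ^ 2)
      + D ^ 2 / η * (1 / ((t : ℝ) + 1) ^ 2) := by
    intro t ht
    have ht' : t ∈ Finset.Icc 1 (T + 1) := by
      rw [Finset.mem_Icc] at ht ⊢
      omega
    obtain ⟨hε0, hε1⟩ := hε t ht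
    refine riod_one_step hXconv hXD hη hμ (by simp) hε0 ?_ (hdiff t ht).1 (hdiff t ht).2
      (hsc t ht).1 (hsc t ht).2 (fun y hy z hz => (hsmooth t ht y hy z hz).2)
      (hxX t ht') (hmem t ht).1 (hxhs t ht).1 (hmem t ht).2 (hxs t ht).1 (hu t ht')
      (hxhs t ht).2 (hxs t ht).2 (hinexact1 t ht) (hinexact2 t ht)
    have hM0 : 0 ≤ 2 * η ^ 2 * M ^ 2 / D ^ 2 := by positivity
    rw [← one_div, div_mul_div_comm, one_mul, le_div_iff₀ (by positivity)] at hε1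
    have : 0 ≤ 8 * η * ε t * ((t : ℝ) + 1) ^ 2 * (2 * η ^ 2 * M ^ 2 / D ^ 2) := by positivity
    linarith
  have hsum := Finset.sum_le_sum hstep
  rw [Finset.sum_add_distrib, Finset.sum_add_distrib, ← Finset.mul_sum, ← Finset.mul_sum] at hsum
  have h1 := mul_le_mul_of_nonneg_left (sum_Icc_sq_norm_sub_telescope_le hXD T hu hxX)
    (by positivity : 0 ≤ 1 / (2 * η))
  have h2 := mul_le_mul_of_nonneg_left (sum_Icc_one_div_add_one_sq_le_one T)
    (by positivity : 0 ≤ D ^ 2 / η)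
  have e : (2 * (∑ t ∈ Finset.Icc 1 T, ‖u t - u (t + 1)‖) * D + 3 * D ^ 2) / (2 * η)
      = 1 / (2 * η) * (2 * (∑ t ∈ Finset.Icc 1 T, ‖u t - u (t + 1)‖) * D + D ^ 2)
        + D ^ 2 / η * 1 := by
    field_simp
    ring
  rw [e]
  linarith
end

section
/- Let E₁, E₂ be finite-dimensional real inner product spaces, L > 0, (x*, y*) ∈ E₁ × E₂, (x_1, y_1) ∈ E₁ × E₂ with R := ‖x_1 − x*‖ + ‖y_1 − y*‖ > 0, and let Z := B̄(x*, 8R) × B̄(y*, 8R) (closed balls). Let f : E₁ × E₂ → ℝ be differentiable, convex-concave and L-smooth on B̄(x*, 8R) × B̄(y*, 8R), with f(x*, y) ≤ f(x*, y*) ≤ f(x, y*) for all (x, y) ∈ Z. Set η := 1/(4L) and ε_t := (L/8)·min{1, 1/(74(t+1)²)}. Let (x_t, y_t, x̃_t, ỹ_t)_{t=1}^{T} be a RIODA trajectory on B̄(x*, 8R) × B̄(y*, 8R) with step η and tolerances ε_t^x = ε_t^y = ε_t. Then for all t: ‖x_t − x*‖ + ‖y_t − y*‖ ≤ 2R and ‖x̃_t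 − x*‖ + ‖ỹ_t − y*‖ ≤ 7R (so all iterates stay in Z), and the averages x̄_T := (1/T)∑_{t=1}^{T} x̃_t, ȳ_T := (1/T)∑_{t=1}^{T} ỹ_t satisfy f(x̄_T, y*) − f(x*, ȳ_T) ≤ 6LR²/T; in particular the duality gap is at most ε for every T ≥ 6LR²/ε. -/
/-- The gap between two convex combinations of squared distances to a common point. -/
lemma norm_sq_lineMap_sub {E : Type*} [NormedAddCommGroup E] [InnerProductSpace ℝ E]
    (p z a : E) (s : ℝ) :
    ‖(1 - s) • p + s • z - a‖ ^ 2
      = (1 - s) * ‖p - a‖ ^ 2 + s * ‖z - a‖ ^ 2 - s * (1 - s) * ‖z - p‖ ^ 2 := by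
  have h1 : (1 - s) • p + s • z - a = (1 - s) • (p - a) + s • (z - a) := by module
  have h2 : z - p = (z - a) - (p - a) := by abel
  rw [h1, h2, norm_add_sq_real, norm_sub_sq_real (z - a), norm_smul, norm_smul, mul_pow, mul_pow,
    inner_smul_left, inner_smul_right, real_inner_comm]
  simp only [Real.norm_eq_abs, sq_abs, conj_trivial]
  ring

/-- Quadratic growth of a proximal objective at its minimizer. -/
lemma ConvexOn.prox_quadratic_growth {E : Type*} [NormedAddCommGroup E] [InnerProductSpace ℝ E]
    {X : Set E} {g : E → ℝ} (hg : ConvexOn ℝ X g) {c : ℝ} {a p z : E}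
    (hp : p ∈ X) (hz : z ∈ X) (hmin : IsMinOn (fun w => g w + c * ‖w - a‖ ^ 2) X p) :
    g p + c * ‖p - a‖ ^ 2 + c * ‖z - p‖ ^ 2 ≤ g z + c * ‖z - a‖ ^ 2 := by
  have key : ∀ s ∈ Set.Ioo (0 : ℝ) 1,
      g p + c * ‖p - a‖ ^ 2 + (1 - s) * (c * ‖z - p‖ ^ 2) ≤ g z + c * ‖z - a‖ ^ 2 := by
    rintro s ⟨hs0, hs1⟩
    have h1s : 0 ≤ 1 - s := by linarith
    have hmem := hg.1 hp hz h1s hs0.le (by ring)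
    have hconv := hg.2 hp hz h1s hs0.le (by ring)
    have hm : g p + c * ‖p - a‖ ^ 2 ≤ g ((1 - s) • p + s • z)
        + c * ‖(1 - s) • p + s • z - a‖ ^ 2 := hmin hmem
    rw [norm_sq_lineMap_sub] at hm
    simp only [smul_eq_mul] at hconv
    refine le_of_mul_le_mul_left ?_ hs0
    linarith
  have hlim : Filter.Tendsto
      (fun s : ℝ => g p + c * ‖p - a‖ ^ 2 + (1 - s) * (c * ‖z - p‖ ^ 2))
      (nhdsWithin 0 (Set.Ioi 0)) (nhds (g p + c * ‖p - a‖ ^ 2 + (1 - 0) * (c * ‖z - p‖ ^ 2))) :=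
    Filter.Tendsto.mono_left (Continuous.tendsto (by fun_prop) 0) nhdsWithin_le_nhds
  have := le_of_tendsto hlim
    (Filter.eventually_of_mem (Ioo_mem_nhdsGT zero_lt_one) key)
  linarith

/-- A bound on the difference of two gradients bounds the variation of the difference. -/
lemma Convex.abs_sub_sub_le_of_norm_gradient_sub_le {E : Type*} [NormedAddCommGroup E]
    [InnerProductSpace ℝ E] [CompleteSpace E] {X : Set E} (hX : Convex ℝ X) {g h : E → ℝ}
    (hg : Differentiable ℝ g) (hh : Differentiable ℝ h) {K : ℝ}
    (hK : ∀ x ∈ X, ‖gradient g x - gradient h x‖ ≤ K) {u v : E} (hu : u ∈ X) (hv : v ∈ X) :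
    |(g u - h u) - (g v - h v)| ≤ K * ‖u - v‖ := by
  have hd : ∀ x ∈ X, HasFDerivWithinAt (fun z => g z - h z)
      (fderiv ℝ g x - fderiv ℝ h x) X x := fun x _ =>
    ((hg x).hasFDerivAt.sub (hh x).hasFDerivAt).hasFDerivWithinAt
  refine hX.norm_image_sub_le_of_norm_hasFDerivWithin_le hd (fun x hx => ?_) hv hu
  have := hK x hx
  rwa [gradient, gradient, ← map_sub, LinearIsometryEquiv.norm_map] at this

/-- One player's step of the inexact optimistic proximal method: `us`, `vs` are the exact proximal
points of `g₀`, `g₁` at `a`, and `u`, `v` are their approximations. -/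
lemma inexact_optimistic_prox_step {E : Type*} [NormedAddCommGroup E] [InnerProductSpace ℝ E]
    {X : Set E} {g₀ g₁ : E → ℝ} (hg₀ : ConvexOn ℝ X g₀) (hg₁ : ConvexOn ℝ X g₁)
    {L α ε B : ℝ} (hL : 0 < L) (hα : 0 < α) (hα1 : α ≤ 1) (hε : ε ≤ L * α / 592)
    {a u us v vs z : E} (hu : u ∈ X) (hus : us ∈ X) (hv : v ∈ X) (hvs : vs ∈ X) (hz : z ∈ X)
    (hlip : (g₁ u - g₀ u) - (g₁ vs - g₀ vs) ≤ L * B * ‖u - vs‖)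
    (husmin : IsMinOn (fun w => g₀ w + 2 * L * ‖w - a‖ ^ 2) X us)
    (hvsmin : IsMinOn (fun w => g₁ w + 2 * L * ‖w - a‖ ^ 2) X vs)
    (hui : g₀ u + 2 * L * ‖u - a‖ ^ 2
      ≤ g₀ us + 2 * L * ‖us - a‖ ^ 2 + ε * ‖a - us‖ ^ 2)
    (hvi : g₁ v + 2 * L * ‖v - a‖ ^ 2
      ≤ g₁ vs + 2 * L * ‖vs - a‖ ^ 2 + ε * ‖a - vs‖ ^ 2) :
    (1 + α) * (g₁ u - g₁ z) + 2 * L * ‖v - z‖ ^ 2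
      ≤ (1 + α) * (2 * L * ‖a - z‖ ^ 2 - L * ‖u - a‖ ^ 2 + L / 2 * B ^ 2) := by
  have q1 := hg₀.prox_quadratic_growth hus hu husmin
  have q2 := hg₁.prox_quadratic_growth hvs hv hvsmin
  have q3 := hg₀.prox_quadratic_growth hus hvs husmin
  have q4 := hg₁.prox_quadratic_growth hvs hz hvsmin
  have t1 : ‖a - us‖ ≤ ‖u - a‖ + ‖u - us‖ := by
    rw [norm_sub_rev u a]; exact norm_sub_le_norm_sub_add_norm_sub a u us
  have t2 : ‖u - vs‖ ≤ ‖u - us‖ + ‖vs - us‖ := by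
    rw [norm_sub_rev vs us]; exact norm_sub_le_norm_sub_add_norm_sub u us vs
  have t3 : ‖a - vs‖ ≤ ‖u - a‖ + (‖u - us‖ + ‖vs - us‖) := by
    rw [norm_sub_rev u a]
    exact (norm_sub_le_norm_sub_add_norm_sub a u vs).trans (by gcongr)
  have t4 : ‖v - z‖ ≤ ‖z - vs‖ + ‖v - vs‖ := by
    rw [add_comm, norm_sub_rev z vs]; exact norm_sub_le_norm_sub_add_norm_sub v vs z
  rw [norm_sub_rev z a] at q4
  have n1 := norm_nonneg (a - us)
  have n2 := norm_nonneg (u - vs)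
  have n3 := norm_nonneg (a - vs)
  have n4 := norm_nonneg (v - z)
  generalize ‖a - us‖ = b at *
  generalize ‖u - vs‖ = d at *
  generalize ‖a - vs‖ = k at *
  generalize ‖v - z‖ = m at *
  generalize ‖z - vs‖ = n at *
  generalize ‖v - vs‖ = r at *
  generalize ‖u - a‖ = A at *
  generalize ‖u - us‖ = e at *
  generalize ‖vs - us‖ = C at *
  have hb : b ^ 2 ≤ 2 * A ^ 2 + 2 * e ^ 2 :=
    (pow_le_pow_left₀ n1 t1 2).trans (by nlinarith [sq_nonneg (A - e)])
  have hd : d ^ 2 ≤ 2 * e ^ 2 + 2 * C ^ 2 :=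
    (pow_le_pow_left₀ n2 t2 2).trans (by nlinarith [sq_nonneg (e - C)])
  have hk : k ^ 2 ≤ 3 * A ^ 2 + 3 * e ^ 2 + 3 * C ^ 2 :=
    (pow_le_pow_left₀ n3 t3 2).trans
      (by nlinarith [sq_nonneg (A - e), sq_nonneg (A - C), sq_nonneg (e - C)])
  have hm : α * m ^ 2 ≤ (1 + α) * (α * n ^ 2 + r ^ 2) :=
    (mul_le_mul_of_nonneg_left (pow_le_pow_left₀ n4 t4 2) hα.le).trans
      (by nlinarith [sq_nonneg (α * n - r)])
  have hr : 1184 * r ^ 2 ≤ α * k ^ 2 := by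
    have h1 : ε * k ^ 2 ≤ L * α / 592 * k ^ 2 := by gcongr
    have h2 : 2 * L * r ^ 2 ≤ ε * k ^ 2 := by linarith only [q2, hvi]
    refine le_of_mul_le_mul_left ?_ hL
    linarith only [h1, h2]
  have hεb : ε * b ^ 2 ≤ L / 592 * b ^ 2 := by
    gcongr
    linarith only [hε, mul_le_mul_of_nonneg_left hα1 hL.le]
  have he : 1184 * e ^ 2 ≤ b ^ 2 := by
    have h1 : 2 * L * e ^ 2 ≤ ε * b ^ 2 := by linarith only [q1, hui]
    refine le_of_mul_le_mul_left ?_ hL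
    linarith only [h1, hεb]
  have hm' : m ^ 2 ≤ (1 + α) * (n ^ 2 + k ^ 2 / 1184) := by
    refine le_of_mul_le_mul_left (hm.trans ?_) hα
    have := mul_le_mul_of_nonneg_left hr (by linarith : (0 : ℝ) ≤ 1 + α)
    linarith only [this]
  have hbd : L * B * d ≤ L / 2 * B ^ 2 + L / 2 * d ^ 2 := by
    linarith only [mul_nonneg hL.le (sq_nonneg (B - d))]
  have hscal : b ^ 2 / 592 + d ^ 2 / 2 + k ^ 2 / 592 ≤ A ^ 2 + 2 * C ^ 2 := by
    linarith only [hb, hd, hk, he, sq_nonneg A, sq_nonneg C]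
  have hscal' := mul_le_mul_of_nonneg_left hscal hL.le
  have hmain : g₁ u - g₁ z + 2 * L * (n ^ 2 + k ^ 2 / 1184)
      ≤ 2 * L * ‖a - z‖ ^ 2 - L * A ^ 2 + L / 2 * B ^ 2 := by
    linarith only [q3, q4, hui, hlip, hbd, hεb, hscal']
  have h1 := mul_le_mul_of_nonneg_left hmain (by linarith : (0 : ℝ) ≤ 1 + α)
  have h2 := mul_le_mul_of_nonneg_left hm' (by linarith : (0 : ℝ) ≤ 2 * L)
  linarith only [h1, h2]

/-- A nonnegative potential that grows by a factor of at most `1 + 1 / (t + 1) ^ 2` at each step,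
after absorbing nonnegative gains, bounds the total gain. -/
lemma sum_add_potential_le {D G : ℕ → ℝ} {T : ℕ} (hG : ∀ t ∈ Finset.Icc 1 T, 0 ≤ G t)
    (hD : 0 ≤ D 1)
    (hstep : ∀ t ∈ Finset.Icc 1 T, G t + D (t + 1) ≤ (1 + 1 / ((t : ℝ) + 1) ^ 2) * D t) :
    ∀ t ≤ T, ∑ s ∈ Finset.Icc 1 t, G s + D (t + 1) ≤ 2 * D 1 * (((t : ℝ) + 1) / (t + 2)) := by
  intro t
  induction t with
  | zero => intro _; simp; linarith
  | succ t ih =>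
    intro ht
    have ih := ih (by omega)
    have hmem : t + 1 ∈ Finset.Icc 1 T := by simp; omega
    have hs := hstep _ hmem
    have hS : 0 ≤ ∑ s ∈ Finset.Icc 1 t, G s :=
      Finset.sum_nonneg fun s hs => hG s (by simp at hs ⊢; omega)
    rw [Finset.sum_Icc_succ_top (by omega)]
    push_cast at hs ⊢
    have hα : (0 : ℝ) ≤ 1 / ((t : ℝ) + 1 + 1) ^ 2 := by positivity
    have h1 := mul_le_mul_of_nonneg_left ih (by linarith : 0 ≤ 1 + 1 / ((t : ℝ) + 1 + 1) ^ 2)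
    have h2 : (1 + 1 / ((t : ℝ) + 1 + 1) ^ 2) * (((t : ℝ) + 1) / (t + 2))
        ≤ ((t : ℝ) + 1 + 1) / (t + 1 + 2) := by
      rw [one_add_div (by positivity), div_mul_div_comm, div_le_div_iff₀ (by positivity)
        (by positivity)]
      have : (0 : ℝ) ≤ t := t.cast_nonneg
      nlinarith [this]
    have h3 := mul_le_mul_of_nonneg_left h2 (by linarith : 0 ≤ 2 * D 1)
    have h4 := mul_nonneg hα hS
    linarith

/-- Jensen's inequality for uniform averages over `Finset.Icc 1 T`. -/
lemma ConvexOn.map_average_Icc_le {E : Type*} [AddCommGroup E] [Module ℝ E] {X : Set E}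
    {g : E → ℝ} (hg : ConvexOn ℝ X g) {T : ℕ} (hT : 0 < T) {u : ℕ → E}
    (hu : ∀ t ∈ Finset.Icc 1 T, u t ∈ X) :
    g ((T : ℝ)⁻¹ • ∑ t ∈ Finset.Icc 1 T, u t) ≤ (T : ℝ)⁻¹ * ∑ t ∈ Finset.Icc 1 T, g (u t) := by
  have hT' : (T : ℝ) ≠ 0 := by positivity
  rw [Finset.smul_sum, Finset.mul_sum]
  refine hg.map_sum_le (fun _ _ => by positivity) ?_ hu
  simp [hT']

/-- **RIODA, unconstrained convex-concave case, Euclidean instance.** Theorem 3.3 of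
"Implicit Riemannian Optimism with Applications to Min-Max Problems": the iterates stay
bounded around the saddle point and the averaged duality gap converges at rate 6LR²/T. -/
theorem rioda_unconstrained_convex_concave
    {E₁ E₂ : Type*}
    [NormedAddCommGroup E₁] [InnerProductSpace ℝ E₁] [FiniteDimensional ℝ E₁]
    [NormedAddCommGroup E₂] [InnerProductSpace ℝ E₂] [FiniteDimensional ℝ E₂]
    (L : ℝ) (hL : 0 < L)
    (xstar : E₁) (ystar : E₂)
    (f : E₁ × E₂ → ℝ) (hdiff : Differentiable ℝ f)
    (R : ℝ) (hR : 0 < R)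
    (hconv : ∀ y ∈ Metric.closedBall ystar (8 * R),
      ConvexOn ℝ (Metric.closedBall xstar (8 * R)) (fun x => f (x, y)))
    (hconc : ∀ x ∈ Metric.closedBall xstar (8 * R),
      ConcaveOn ℝ (Metric.closedBall ystar (8 * R)) (fun y => f (x, y)))
    (hsmooth_xx : ∀ y ∈ Metric.closedBall ystar (8 * R),
      ∀ x ∈ Metric.closedBall xstar (8 * R), ∀ x' ∈ Metric.closedBall xstar (8 * R),
      ‖gradient (fun z => f (z, y)) x - gradient (fun z => f (z, y)) x'‖ ≤ L * ‖x - x'‖)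
    (hsmooth_yy : ∀ x ∈ Metric.closedBall xstar (8 * R),
      ∀ y ∈ Metric.closedBall ystar (8 * R), ∀ y' ∈ Metric.closedBall ystar (8 * R),
      ‖gradient (fun w => f (x, w)) y - gradient (fun w => f (x, w)) y'‖ ≤ L * ‖y - y'‖)
    (hsmooth_xy : ∀ x ∈ Metric.closedBall xstar (8 * R),
      ∀ y ∈ Metric.closedBall ystar (8 * R), ∀ y' ∈ Metric.closedBall ystar (8 * R),
      ‖gradient (fun z => f (z, y)) x - gradient (fun z => f (z, y')) x‖ ≤ L * ‖y - y'‖)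
    (hsmooth_yx : ∀ y ∈ Metric.closedBall ystar (8 * R),
      ∀ x ∈ Metric.closedBall xstar (8 * R), ∀ x' ∈ Metric.closedBall xstar (8 * R),
      ‖gradient (fun w => f (x, w)) y - gradient (fun w => f (x', w)) y‖ ≤ L * ‖x - x'‖)
    (hsaddle : ∀ x ∈ Metric.closedBall xstar (8 * R), ∀ y ∈ Metric.closedBall ystar (8 * R),
      f (xstar, y) ≤ f (xstar, ystar) ∧ f (xstar, ystar) ≤ f (x, ystar))
    (η : ℝ) (hη : η = 1 / (4 * L))
    (ε : ℕ → ℝ) (hεdef : ∀ t, ε t = L / 8 * min 1 (1 / (74 * ((t : ℝ) + 1) ^ 2)))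
    (T : ℕ) (hT : 0 < T)
    (x xt xts xns : ℕ → E₁) (y yt yts yns : ℕ → E₂)
    (hx1 : x 1 ∈ Metric.closedBall xstar (8 * R)) (hy1 : y 1 ∈ Metric.closedBall ystar (8 * R))
    (hRdef : R = ‖x 1 - xstar‖ + ‖y 1 - ystar‖)
    (hmem : ∀ t ∈ Finset.Icc 1 T, xt t ∈ Metric.closedBall xstar (8 * R)
      ∧ yt t ∈ Metric.closedBall ystar (8 * R)
      ∧ x (t + 1) ∈ Metric.closedBall xstar (8 * R)
      ∧ y (t + 1) ∈ Metric.closedBall ystar (8 * R))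
    (hxts : ∀ t ∈ Finset.Icc 1 T, xts t ∈ Metric.closedBall xstar (8 * R) ∧
      IsMinOn (fun z => f (z, y t) + 1 / (2 * η) * ‖z - x t‖ ^ 2)
        (Metric.closedBall xstar (8 * R)) (xts t))
    (hyts : ∀ t ∈ Finset.Icc 1 T, yts t ∈ Metric.closedBall ystar (8 * R) ∧
      IsMaxOn (fun w => f (x t, w) - 1 / (2 * η) * ‖w - y t‖ ^ 2)
        (Metric.closedBall ystar (8 * R)) (yts t))
    (hxns : ∀ t ∈ Finset.Icc 1 T, xns (t + 1) ∈ Metric.closedBall xstar (8 * R) ∧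
      IsMinOn (fun z => f (z, yt t) + 1 / (2 * η) * ‖z - x t‖ ^ 2)
        (Metric.closedBall xstar (8 * R)) (xns (t + 1)))
    (hyns : ∀ t ∈ Finset.Icc 1 T, yns (t + 1) ∈ Metric.closedBall ystar (8 * R) ∧
      IsMaxOn (fun w => f (xt t, w) - 1 / (2 * η) * ‖w - y t‖ ^ 2)
        (Metric.closedBall ystar (8 * R)) (yns (t + 1)))
    (hin1 : ∀ t ∈ Finset.Icc 1 T,
      f (xt t, y t) + 1 / (2 * η) * ‖xt t - x t‖ ^ 2
        ≤ f (xts t, y t) + 1 / (2 * η) * ‖xts t - x t‖ ^ 2 + ε t * ‖x t - xts t‖ ^ 2)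
    (hin2 : ∀ t ∈ Finset.Icc 1 T,
      -f (x t, yt t) + 1 / (2 * η) * ‖yt t - y t‖ ^ 2
        ≤ -f (x t, yts t) + 1 / (2 * η) * ‖yts t - y t‖ ^ 2 + ε t * ‖y t - yts t‖ ^ 2)
    (hin3 : ∀ t ∈ Finset.Icc 1 T,
      f (x (t + 1), yt t) + 1 / (2 * η) * ‖x (t + 1) - x t‖ ^ 2
        ≤ f (xns (t + 1), yt t) + 1 / (2 * η) * ‖xns (t + 1) - x t‖ ^ 2
          + ε t * ‖x t - xns (t + 1)‖ ^ 2)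
    (hin4 : ∀ t ∈ Finset.Icc 1 T,
      -f (xt t, y (t + 1)) + 1 / (2 * η) * ‖y (t + 1) - y t‖ ^ 2
        ≤ -f (xt t, yns (t + 1)) + 1 / (2 * η) * ‖yns (t + 1) - y t‖ ^ 2
          + ε t * ‖y t - yns (t + 1)‖ ^ 2) :
    (∀ t ∈ Finset.Icc 1 (T + 1), ‖x t - xstar‖ + ‖y t - ystar‖ ≤ 2 * R)
    ∧ (∀ t ∈ Finset.Icc 1 T, ‖xt t - xstar‖ + ‖yt t - ystar‖ ≤ 7 * R)
    ∧ f ((T : ℝ)⁻¹ • ∑ t ∈ Finset.Icc 1 T, xt t, ystar)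
        - f (xstar, (T : ℝ)⁻¹ • ∑ t ∈ Finset.Icc 1 T, yt t)
      ≤ 6 * L * R ^ 2 / T
    ∧ (∀ ε' : ℝ, 0 < ε' → (T : ℝ) ≥ 6 * L * R ^ 2 / ε' →
        f ((T : ℝ)⁻¹ • ∑ t ∈ Finset.Icc 1 T, xt t, ystar)
            - f (xstar, (T : ℝ)⁻¹ • ∑ t ∈ Finset.Icc 1 T, yt t) ≤ ε') := by
  set X := Metric.closedBall xstar (8 * R)
  set Y := Metric.closedBall ystar (8 * R)
  have hη' : 1 / (2 * η) = 2 * L := by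
    rw [hη]
    field_simp
    norm_num
  simp only [hη'] at hxts hyts hxns hyns hin1 hin2 hin3 hin4
  have hxs : xstar ∈ X := Metric.mem_closedBall_self (by positivity)
  have hys : ystar ∈ Y := Metric.mem_closedBall_self (by positivity)
  have hxmem : ∀ t ∈ Finset.Icc 1 T, x t ∈ X := by
    rintro (_ | _ | t) ht
    · simp at ht
    · exact hx1
    · exact (hmem (t + 1) (by simp at ht ⊢; omega)).2.2.1
  have hymem : ∀ t ∈ Finset.Icc 1 T, y t ∈ Y := by
    rintro (_ | _ | t) ht
    · simp at ht
    · exact hy1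
    · exact (hmem (t + 1) (by simp at ht ⊢; omega)).2.2.2
  set G : ℕ → ℝ := fun t => f (xt t, ystar) - f (xstar, yt t) with hGdef
  set D : ℕ → ℝ := fun t => ‖x t - xstar‖ ^ 2 + ‖y t - ystar‖ ^ 2 with hDdef
  have hG : ∀ t ∈ Finset.Icc 1 T, 0 ≤ G t := fun t ht => by
    obtain ⟨h1, h2, -, -⟩ := hmem t ht
    have h3 := (hsaddle _ h1 _ h2).1
    have h4 := (hsaddle _ h1 _ h2).2
    simp only [hGdef]
    linarith
  have hstep : ∀ t ∈ Finset.Icc 1 T,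
      (1 + 1 / ((t : ℝ) + 1) ^ 2) * G t + 2 * L * D (t + 1) ≤ (1 + 1 / ((t : ℝ) + 1) ^ 2) *
        (2 * L * D t - L / 2 * (‖xt t - x t‖ ^ 2 + ‖yt t - y t‖ ^ 2)) := by
    intro t ht
    obtain ⟨m1, m2, m3, m4⟩ := hmem t ht
    have hα : (0 : ℝ) < 1 / ((t : ℝ) + 1) ^ 2 := by positivity
    have hα1 : 1 / ((t : ℝ) + 1) ^ 2 ≤ 1 := by
      rw [div_le_one (by positivity)]
      nlinarith [(t.cast_nonneg : (0 : ℝ) ≤ t)]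
    have hε : ε t ≤ L * (1 / ((t : ℝ) + 1) ^ 2) / 592 := by
      rw [hεdef]
      calc L / 8 * min 1 (1 / (74 * ((t : ℝ) + 1) ^ 2))
          ≤ L / 8 * (1 / (74 * ((t : ℝ) + 1) ^ 2)) := by gcongr; exact min_le_right _ _
        _ = L * (1 / ((t : ℝ) + 1) ^ 2) / 592 := by field_simp; norm_num
    have hlx := (convex_closedBall xstar (8 * R)).abs_sub_sub_le_of_norm_gradient_sub_le
      (g := fun z => f (z, yt t)) (h := fun z => f (z, y t)) (by fun_prop) (by fun_prop)
      (fun z hz => hsmooth_xy z hz _ m2 _ (hymem t ht)) m1 (hxns t ht).1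
    have hly := (convex_closedBall ystar (8 * R)).abs_sub_sub_le_of_norm_gradient_sub_le
      (g := fun w => f (xt t, w)) (h := fun w => f (x t, w)) (by fun_prop) (by fun_prop)
      (fun w hw => hsmooth_yx w hw _ m1 _ (hxmem t ht)) m2 (hyns t ht).1
    have hsx := inexact_optimistic_prox_step (hconv _ (hymem t ht)) (hconv _ m2) hL hα hα1 hε
      m1 (hxts t ht).1 m3 (hxns t ht).1 hxs (abs_le.1 hlx).2 (hxts t ht).2 (hxns t ht).2
      (hin1 t ht) (hin3 t ht)
    have hsy := inexact_optimistic_prox_step (g₀ := fun w => -f (x t, w))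
      (g₁ := fun w => -f (xt t, w)) (B := ‖xt t - x t‖)
      (hconc _ (hxmem t ht)).neg (hconc _ m1).neg hL hα hα1 hε
      m2 (hyts t ht).1 m4 (hyns t ht).1 hys (by have := (abs_le.1 hly).1; linarith)
      (fun w hw => by
        have h : f (x t, w) - 2 * L * ‖w - y t‖ ^ 2
          ≤ f (x t, yts t) - 2 * L * ‖yts t - y t‖ ^ 2 := (hyts t ht).2 hw
        simp only [Set.mem_ofPred_eq]
        linarith)
      (fun w hw => by
        have h : f (xt t, w) - 2 * L * ‖w - y t‖ ^ 2
          ≤ f (xt t, yns (t + 1)) - 2 * L * ‖yns (t + 1) - y t‖ ^ 2 := (hyns t ht).2 hw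
        simp only [Set.mem_ofPred_eq]
        linarith)
      (hin2 t ht) (hin4 t ht)
    simp only [hGdef, hDdef]
    linarith
  have hpot := sum_add_potential_le (D := fun t => 2 * L * D t) hG (by positivity)
    (fun t ht => by
      have h1 := hstep t ht
      have hα : (0 : ℝ) ≤ 1 / ((t : ℝ) + 1) ^ 2 := by positivity
      have h2 := mul_nonneg hα (hG t ht)
      have h3 : 0 ≤ (1 + 1 / ((t : ℝ) + 1) ^ 2) *
        (L / 2 * (‖xt t - x t‖ ^ 2 + ‖yt t - y t‖ ^ 2)) := by positivity
      linarith)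
  have hD1 : D 1 ≤ R ^ 2 := by
    simp only [hDdef]
    rw [hRdef]
    nlinarith [mul_nonneg (norm_nonneg (x 1 - xstar)) (norm_nonneg (y 1 - ystar))]
  have hpot' : ∀ t ≤ T, ∑ s ∈ Finset.Icc 1 t, G s + 2 * L * D (t + 1) ≤ 4 * L * R ^ 2 := by
    intro t ht
    have h1 : ((t : ℝ) + 1) / (t + 2) ≤ 1 := by
      rw [div_le_one (by positivity)]
      linarith
    calc _ ≤ 2 * (2 * L * D 1) * (((t : ℝ) + 1) / (t + 2)) := hpot t ht
      _ ≤ 2 * (2 * L * R ^ 2) * 1 := by gcongr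
      _ = 4 * L * R ^ 2 := by ring
  have hDle : ∀ t ∈ Finset.Icc 1 (T + 1), D t ≤ 2 * R ^ 2 := by
    rintro (_ | t) ht
    · simp at ht
    · have htT : t ≤ T := by simp at ht; omega
      have hS : 0 ≤ ∑ s ∈ Finset.Icc 1 t, G s :=
        Finset.sum_nonneg fun s hs => hG s (by simp at hs ⊢; omega)
      have := hpot' t htT
      refine le_of_mul_le_mul_left ?_ (by positivity : 0 < 2 * L)
      linarith
  have hbound : ∀ t ∈ Finset.Icc 1 (T + 1), ‖x t - xstar‖ + ‖y t - ystar‖ ≤ 2 * R := by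
    intro t ht
    have h : ‖x t - xstar‖ ^ 2 + ‖y t - ystar‖ ^ 2 ≤ 2 * R ^ 2 := hDle t ht
    refine (pow_le_pow_iff_left₀ (by positivity) (by positivity) two_ne_zero).1 ?_
    nlinarith [sq_nonneg (‖x t - xstar‖ - ‖y t - ystar‖)]
  have hgap : f ((T : ℝ)⁻¹ • ∑ t ∈ Finset.Icc 1 T, xt t, ystar)
      - f (xstar, (T : ℝ)⁻¹ • ∑ t ∈ Finset.Icc 1 T, yt t) ≤ 6 * L * R ^ 2 / T := by
    have hx := (hconv _ hys).map_average_Icc_le hT (u := xt) fun t ht => (hmem t ht).1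
    have hy := (hconc _ hxs).neg.map_average_Icc_le hT (u := yt) fun t ht => (hmem t ht).2.1
    simp only [Pi.neg_apply, Finset.sum_neg_distrib] at hy
    have hS : ∑ t ∈ Finset.Icc 1 T, f (xt t, ystar) - ∑ t ∈ Finset.Icc 1 T, f (xstar, yt t)
        ≤ 6 * L * R ^ 2 := by
      have h := hpot' T le_rfl
      have h1 : 0 ≤ 2 * L * D (T + 1) := by positivity
      have h2 : 0 ≤ L * R ^ 2 := by positivity
      simp only [hGdef, Finset.sum_sub_distrib] at h
      linarith
    have := mul_le_mul_of_nonneg_left hS (by positivity : 0 ≤ (T : ℝ)⁻¹)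
    rw [div_eq_inv_mul]
    linarith
  refine ⟨hbound, fun t ht => ?_, hgap, fun ε' hε' hTε => hgap.trans ?_⟩
  · have ht' : t ∈ Finset.Icc 1 (T + 1) := by simp at ht ⊢; omega
    have h1 := hbound t ht'
    have h2 := hDle t ht'
    have hα : (0 : ℝ) < 1 + 1 / ((t : ℝ) + 1) ^ 2 := by positivity
    have h3 : 0 ≤ 2 * L * D t - L / 2 * (‖xt t - x t‖ ^ 2 + ‖yt t - y t‖ ^ 2) := by
      refine nonneg_of_mul_nonneg_right (le_trans ?_ (hstep t ht)) hα
      have := mul_nonneg hα.le (hG t ht)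
      positivity
    have h4 : ‖xt t - x t‖ ^ 2 + ‖yt t - y t‖ ^ 2 ≤ 8 * R ^ 2 := by
      refine le_of_mul_le_mul_left ?_ hL
      have := mul_le_mul_of_nonneg_left h2 hL.le
      linarith
    have h5 : ‖xt t - x t‖ + ‖yt t - y t‖ ≤ 4 * R := by
      refine (pow_le_pow_iff_left₀ (by positivity) (by positivity) two_ne_zero).1 ?_
      nlinarith [sq_nonneg (‖xt t - x t‖ - ‖yt t - y t‖)]
    have h6 := norm_sub_le_norm_sub_add_norm_sub (xt t) (x t) xstar
    have h7 := norm_sub_le_norm_sub_add_norm_sub (yt t) (y t) ystar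
    linarith
  · rw [ge_iff_le, div_le_iff₀ hε'] at hTε
    rw [div_le_iff₀ (by positivity)]
    linarith
end
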